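/- arXiv:2409.06521 — 3 statements merged into one kernel-verified Lean document; each statement's English description precedes it below -/
import Mathlib

section
/- Let w̄ and w be two edge-weight functions on a finite vertex type V with w̄(u,v) ≤ w(u,v) for all u, v ∈ V. Suppose π is a path from s to t such that (i) the cost of π under w̄ is less than or equal to the cost under w̄ of every path from s to t, and (ii) w̄(vᵢ, vᵢ₊₁) = w(vᵢ, vᵢ₊₁) for every consecutive pair of vertices of π (all edges of π are evaluated). Then the cost of π under w is less than or equal to the cost under w of every path from s to t; moreover cost_w(π) = d_w̄(s,t) = d_w(s,t). -/
open scoped ENNReal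

/-- The cost of a path (a finite list of vertices) under an edge-weight
function `w`: the sum of `w vᵢ vᵢ₊₁` over consecutive pairs. -/
noncomputable def pathCost {V : Type*} (w : V → V → ℝ≥0∞) (π : List V) : ℝ≥0∞ :=
  ((π.zip π.tail).map fun p => w p.1 p.2).sum

/-- `π` is a path from `s` to `t`: a nonempty finite list of vertices
starting at `s` and ending at `t`. -/
def IsPath {V : Type*} (s t : V) (π : List V) : Prop :=
  π.head? = some s ∧ π.getLast? = some t

/-- The distance from `s` to `t` under `w`: the infimum (in `ℝ≥0∞`) of the
costs of all paths from `s` to `t`. -/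
noncomputable def graphDist {V : Type*} (w : V → V → ℝ≥0∞) (s t : V) : ℝ≥0∞ :=
  ⨅ π ∈ {π : List V | IsPath s t π}, pathCost w π

/-- The cost of a path is monotone in the edge weights. -/
theorem pathCost_mono {V : Type*} {w₁ w₂ : V → V → ℝ≥0∞} (h : ∀ u v : V, w₁ u v ≤ w₂ u v)
    (π : List V) : pathCost w₁ π ≤ pathCost w₂ π :=
  List.sum_le_sum fun p _ => h p.1 p.2

/-- The cost of a path depends only on the weights of its edges. -/
theorem pathCost_congr {V : Type*} {w₁ w₂ : V → V → ℝ≥0∞} {π : List V}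
    (h : ∀ p ∈ π.zip π.tail, w₁ p.1 p.2 = w₂ p.1 p.2) : pathCost w₁ π = pathCost w₂ π :=
  congrArg List.sum (List.map_congr_left h)

/-- The distance is the cost of any optimal path. -/
theorem graphDist_eq_pathCost {V : Type*} {w : V → V → ℝ≥0∞} {s t : V} {π : List V}
    (hπ : IsPath s t π) (hopt : ∀ π' : List V, IsPath s t π' → pathCost w π ≤ pathCost w π') :
    graphDist w s t = pathCost w π :=
  le_antisymm (iInf₂_le π hπ) (le_iInf₂ hopt)

/-- if `w̄ ≤ w` pointwise, `π` is a path from `s` to `t` optimal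
with respect to the lazy weights `w̄`, and all edges of `π` are evaluated
(`w̄ = w` on every consecutive pair of `π`), then `π` is optimal with respect
to the true weights `w`; moreover `cost_w(π) = d_w̄(s,t) = d_w(s,t)`. -/
theorem evaluated_lazy_optimal_is_optimal {V : Type*} [Fintype V]
    (wbar w : V → V → ℝ≥0∞) (hle : ∀ u v : V, wbar u v ≤ w u v)
    (s t : V) (π : List V) (hπ : IsPath s t π)
    (hopt : ∀ π' : List V, IsPath s t π' → pathCost wbar π ≤ pathCost wbar π')
    (heval : ∀ p ∈ π.zip π.tail, wbar p.1 p.2 = w p.1 p.2) :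
    (∀ π' : List V, IsPath s t π' → pathCost w π ≤ pathCost w π') ∧
      pathCost w π = graphDist wbar s t ∧ graphDist wbar s t = graphDist w s t := by
  have hcost := pathCost_congr heval
  have hopt_w : ∀ π' : List V, IsPath s t π' → pathCost w π ≤ pathCost w π' := fun π' hπ' =>
    hcost ▸ (hopt π' hπ').trans (pathCost_mono hle π')
  have hdist := graphDist_eq_pathCost hπ hopt
  exact ⟨hopt_w, (hdist.trans hcost).symm,
    (hdist.trans hcost).trans (graphDist_eq_pathCost hπ hopt_w).symm⟩
end

section
/- Let V be a finite vertex type, w an edge-weight function taking values in (0, ∞] (strictly positive weights), goal ∈ V, p : V → V a parent map, and lmc : V → ℝ≥0∞ with lmc(goal) = 0. Assume that for every v ≠ goal with lmc(v) < ∞ one has lmc(v) = w(v, p(v)) + lmc(p(v)). Then for every v with lmc(v) < ∞ there exists k ≤ card(V) with p^[k](v) = goal, and the path v, p(v), p²(v), …, p^[k](v) from v to goal has cost under w exactly lmc(v). -/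
open scoped ENNReal

theorem pathCost_cons_cons {V : Type*} (w : V → V → ℝ≥0∞) (a b : V) (l : List V) :
    pathCost w (a :: b :: l) = w a b + pathCost w (b :: l) := by
  simp [pathCost]

theorem pathCost_iterate_succ {V : Type*} (w : V → V → ℝ≥0∞) (p : V → V) (k : ℕ) (v : V) :
    pathCost w ((List.range (k + 2)).map fun i => p^[i] v) =
      w v (p v) + pathCost w ((List.range (k + 1)).map fun i => p^[i] (p v)) := by
  simp [List.range_succ_eq_map, pathCost_cons_cons, Function.comp_def]

/-- with strictly positive edge weights, a parent map `p` and
look-ahead values `lmc` with `lmc goal = 0` such that every non-goal vertex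
with finite `lmc`-value satisfies `lmc v = w v (p v) + lmc (p v)`, tracing
parent pointers from any vertex `v` with finite `lmc`-value reaches `goal`
in at most `card V` steps, and the resulting path
`v, p v, p² v, …, p^[k] v` has cost exactly `lmc v`. -/
theorem parent_chain_reaches_goal {V : Type*} [Fintype V]
    (w : V → V → ℝ≥0∞) (hpos : ∀ u v : V, 0 < w u v)
    (goal : V) (p : V → V) (lmc : V → ℝ≥0∞)
    (hgoal : lmc goal = 0)
    (hcons : ∀ v : V, v ≠ goal → lmc v < ⊤ → lmc v = w v (p v) + lmc (p v)) :
    ∀ v : V, lmc v < ⊤ →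
      ∃ k ≤ Fintype.card V, p^[k] v = goal ∧
        pathCost w ((List.range (k + 1)).map fun i => p^[i] v) = lmc v := by
  classical
  suffices h : ∀ n : ℕ, ∀ v : V, lmc v < ⊤ →
      (Finset.univ.filter fun u => lmc u < lmc v).card ≤ n →
      ∃ k ≤ n, p^[k] v = goal ∧
        pathCost w ((List.range (k + 1)).map fun i => p^[i] v) = lmc v from
    fun v hv => h _ v hv (Finset.card_le_univ _)
  intro n
  induction n with
  | zero =>
    intro v hv hcard
    have hvg : v = goal := by
      by_contra hne
      have hlt : lmc goal < lmc v := by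
        rw [hgoal, hcons v hne hv]
        exact (hpos v (p v)).trans_le le_self_add
      exact (Finset.card_pos.2 ⟨goal, by simpa using hlt⟩).not_ge hcard
    exact ⟨0, le_rfl, hvg, by simp [pathCost, hvg, hgoal]⟩
  | succ n ih =>
    intro v hv hcard
    by_cases hvg : v = goal
    · exact ⟨0, Nat.zero_le _, hvg, by simp [pathCost, hvg, hgoal]⟩
    have hstep := hcons v hvg hv
    have hpv : lmc (p v) < ⊤ := lt_of_le_of_lt (hstep ▸ le_add_self) hv
    have hlt : lmc (p v) < lmc v := by
      rw [hstep, add_comm]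
      exact ENNReal.lt_add_right hpv.ne (hpos v (p v)).ne'
    have hsub : (Finset.univ.filter fun u => lmc u < lmc (p v)) ⊂
        Finset.univ.filter fun u => lmc u < lmc v := by
      refine Finset.ssubset_iff_of_subset ?_ |>.2 ⟨p v, by simpa using hlt, by simp⟩
      exact Finset.monotone_filter_right _ fun u _ hu => hu.trans hlt
    obtain ⟨k, hk, hkg, hcost⟩ := ih (p v) hpv
      (Nat.le_of_lt_succ ((Finset.card_lt_card hsub).trans_le hcard))
    exact ⟨k + 1, Nat.succ_le_succ hk, hkg, by rw [pathCost_iterate_succ, hcost, ← hstep]⟩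
end

section
/- Let V be a finite vertex type, w an edge-weight function taking values in (0, ∞], goal ∈ V, p : V → V, and lmc : V → ℝ≥0∞ with lmc(goal) = 0. Assume (i) lmc(u) ≤ w(u,v) + lmc(v) for all u, v ∈ V, and (ii) for every v ≠ goal with lmc(v) < ∞, lmc(v) = w(v, p(v)) + lmc(p(v)). Then lmc(v) = d_w(v, goal) for every v ∈ V with lmc(v) < ∞. -/
open scoped ENNReal

theorem le_pathCost_add_of_isPath {V : Type*} {w : V → V → ℝ≥0∞} {f : V → ℝ≥0∞}
    (hf : ∀ u v : V, f u ≤ w u v + f v) {s t : V} {π : List V} (h : IsPath s t π) :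
    f s ≤ pathCost w π + f t := by
  induction π generalizing s with
  | nil => simp [IsPath] at h
  | cons a l ih =>
    obtain ⟨hs, ht⟩ := h
    obtain rfl : a = s := by simpa using hs
    cases l with
    | nil =>
      obtain rfl : a = t := by simpa using ht
      exact le_add_self
    | cons b l =>
      rw [List.getLast?_cons_cons] at ht
      rw [pathCost_cons_cons, add_assoc]
      exact (hf a b).trans (by gcongr; exact ih ⟨rfl, ht⟩)

theorem graphDist_self {V : Type*} (w : V → V → ℝ≥0∞) (v : V) : graphDist w v v = 0 :=
  le_antisymm (iInf₂_le_of_le [v] ⟨rfl, rfl⟩ (by simp [pathCost])) zero_le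

theorem graphDist_le_add {V : Type*} (w : V → V → ℝ≥0∞) (u v t : V) :
    graphDist w u t ≤ w u v + graphDist w v t := by
  simp only [graphDist, ENNReal.add_iInf]
  refine le_iInf fun π => ?_
  by_cases hπ : IsPath v t π
  · obtain ⟨l, rfl⟩ : ∃ l, π = v :: l := by
      cases π with
      | nil => simp [IsPath] at hπ
      | cons a l => exact ⟨l, by simpa using hπ.1⟩
    simp only [Set.mem_ofPred_eq, hπ, iInf_pos]
    rw [← pathCost_cons_cons]
    refine iInf₂_le (u :: v :: l) ⟨rfl, ?_⟩
    rw [List.getLast?_cons_cons]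
    exact hπ.2
  · simp [hπ]

/-- with strictly positive edge weights, if `lmc goal = 0`,
`lmc` satisfies the shortest-path optimality condition
`lmc u ≤ w u v + lmc v` for all `u v`, and every non-goal vertex with finite
`lmc`-value satisfies the parent-chain equality `lmc v = w v (p v) + lmc (p v)`,
then `lmc v` equals the minimum cost-to-goal `d_w(v, goal)` for every vertex
`v` with finite `lmc`-value. -/
theorem lmc_eq_dist_of_consistent {V : Type*} [Fintype V]
    (w : V → V → ℝ≥0∞) (hpos : ∀ u v : V, 0 < w u v)
    (goal : V) (p : V → V) (lmc : V → ℝ≥0∞)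
    (hgoal : lmc goal = 0)
    (hopt : ∀ u v : V, lmc u ≤ w u v + lmc v)
    (hcons : ∀ v : V, v ≠ goal → lmc v < ⊤ → lmc v = w v (p v) + lmc (p v)) :
    ∀ v : V, lmc v < ⊤ → lmc v = graphDist w v goal := by
  intro v hv
  refine le_antisymm (le_iInf₂ fun π hπ => ?_) ?_
  · simpa [hgoal] using le_pathCost_add_of_isPath hopt hπ
  · have hwf : WellFounded fun a b : V => lmc a < lmc b := by
      have : IsTrans V fun a b => lmc a < lmc b := ⟨fun _ _ _ => lt_trans⟩
      have : Std.Irrefl fun a b : V => lmc a < lmc b := ⟨fun _ => lt_irrefl _⟩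
      exact Finite.wellFounded_of_trans_of_irrefl _
    induction v using hwf.induction with
    | _ v ih =>
      by_cases hvg : v = goal
      · rw [hvg, graphDist_self]
        exact zero_le
      · have heq := hcons v hvg hv
        have hlt : lmc (p v) < lmc v := by
          have hfin : lmc (p v) ≠ ⊤ := ((heq ▸ le_add_self).trans_lt hv).ne
          rw [heq, add_comm]
          exact ENNReal.lt_add_right hfin (hpos v (p v)).ne'
        rw [heq]
        refine (graphDist_le_add w v (p v) goal).trans ?_
        gcongr
        exact ih (p v) hlt (hlt.trans hv)
end
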